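/- Let T be stable and κ = κ^{|T|} regular. If A₁ is relatively κ-saturated in A and D is κ-atomic over A₁, then D is independent from A over A₁ (in the sense of nonforking). -/

import Mathlib

open FirstOrder Language Cardinal

universe u

namespace Benign

variable {L : FirstOrder.Language.{u, u}} {M : Type u} [L.Structure M]

/-- Two tuples (indexed by a type `α`) realize the same complete `L`-type over the
parameter set `A`. -/
def SameTypeOver (A : Set M) {α : Type} (x y : α → M) : Prop :=
  ∀ φ : L.Formula (α ⊕ ↥A),
    φ.Realize (Sum.elim x Subtype.val) ↔ φ.Realize (Sum.elim y Subtype.val)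

/-- Two tuples realize the same strong type over `A`: they realize the same type over `A`,
and they are equivalent under every `A`-definable equivalence relation with finitely many
classes. -/
def SameStrongTypeOver (A : Set M) {α : Type} (x y : α → M) : Prop :=
  SameTypeOver (L := L) A x y ∧
    ∀ φ : L.Formula ((α ⊕ α) ⊕ ↥A),
      (Equivalence fun u v : α → M => φ.Realize (Sum.elim (Sum.elim u v) Subtype.val)) →
      (∃ k : ℕ, ∀ g : Fin (k + 1) → α → M, ∃ i j, i ≠ j ∧
          φ.Realize (Sum.elim (Sum.elim (g i) (g j)) Subtype.val)) →
      φ.Realize (Sum.elim (Sum.elim x y) Subtype.val)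

/-- The language consisting of a single unary predicate symbol `P`. -/
def unaryLang : FirstOrder.Language.{0, 0} := ⟨fun _ => Empty, fun n => PLift (n = 1)⟩

/-- The interpretation of the unary predicate `P` as membership in `A`. -/
def unaryStructure (A : Set M) : unaryLang.Structure M where
  funMap := fun f _ => f.elim
  RelMap := fun {n} r v => v (Fin.cast r.down.symm 0) ∈ A

/-- Two tuples realize the same type over `A` in the expanded language
`L* = L ∪ {P}` where the new unary predicate `P` is interpreted as `A`. -/
def SameLstarTypeOver (A : Set M) {α : Type} (x y : α → M) : Prop :=
  letI : unaryLang.Structure M := unaryStructure A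
  SameTypeOver (L := L.sum unaryLang) A x y

/-- `A` is benign in `M`: tuples with the same `L`-type over `A` have the same `L*`-type
over `A`. -/
def IsBenign (A : Set M) : Prop :=
  ∀ (n : ℕ) (x y : Fin n → M),
    SameTypeOver (L := L) A x y → SameLstarTypeOver (L := L) A x y

/-- `A` is weakly benign in `M`: tuples with the same strong type over `A` have the same
`L*`-type over `A`. -/
def IsWeaklyBenign (A : Set M) : Prop :=
  ∀ (n : ℕ) (x y : Fin n → M),
    SameStrongTypeOver (L := L) A x y → SameLstarTypeOver (L := L) A x y


/-- The cardinality of the theory: `|T| = |L| + ℵ₀`. -/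
noncomputable def cardL (L : FirstOrder.Language.{u, u}) : Cardinal.{u} :=
  L.card ⊔ ℵ₀

/-- `T` is stable in `κ`: over every parameter set of size at most `κ` in a model of `T`
there are at most `κ` complete types. -/
def StableIn (L : FirstOrder.Language.{u, u}) (T : L.Theory) (κ : Cardinal.{u}) : Prop :=
  ∀ (N : Type u) (_ : L.Structure N), N ⊨ T → ∀ A : Set N, #A ≤ κ →
    ∀ n : ℕ, #(((L[[↥A]]).completeTheory N).CompleteType (Fin n)) ≤ κ

/-- `T` is stable: stable in some cardinal. -/
def Stable (L : FirstOrder.Language.{u, u}) (T : L.Theory) : Prop :=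
  ∃ κ, StableIn L T κ

/-- `T` is superstable: stable in every cardinal `κ ≥ 2 ^ |T|`. -/
def Superstable (L : FirstOrder.Language.{u, u}) (T : L.Theory) : Prop :=
  ∀ κ : Cardinal.{u}, 2 ^ cardL L ≤ κ → StableIn L T κ

/-- `T` is `ω`-stable. -/
def OmegaStable (L : FirstOrder.Language.{u, u}) (T : L.Theory) : Prop :=
  StableIn L T ℵ₀

/-- `M` is `κ`-saturated as an `L'`-structure: every finitely satisfiable set of
`L'`-formulas in one free variable over fewer than `κ` parameters is realized. -/
def SaturatedIn (L' : FirstOrder.Language.{u, u}) [L'.Structure M] (κ : Cardinal.{u}) : Prop :=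
  ∀ S : Set M, #S < κ →
    ∀ p : Set (L'.Formula (Fin 1 ⊕ ↥S)),
      (∀ fs : Finset (L'.Formula (Fin 1 ⊕ ↥S)), ↑fs ⊆ p →
        ∃ x : M, ∀ φ ∈ fs, φ.Realize (Sum.elim ![x] Subtype.val)) →
      ∃ x : M, ∀ φ ∈ p, φ.Realize (Sum.elim ![x] Subtype.val)

/-- The pair `(M, A)` is `κ`-saturated as a structure in the language `L* = L ∪ {P}`. -/
def PairSaturated (A : Set M) (κ : Cardinal.{u}) : Prop :=
  letI : unaryLang.Structure M := unaryStructure A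
  SaturatedIn (M := M) (L.sum unaryLang) κ

/-- A subset `N ⊆ M` is (the universe of) an elementary substructure of `M`
(Tarski–Vaught test). -/
def ElemSubset (N : Set M) : Prop :=
  N.Nonempty ∧
    ∀ (n : ℕ) (φ : L.BoundedFormula (Fin n) 1) (a : Fin n → M), (∀ i, a i ∈ N) →
      (∃ x : M, φ.Realize a ![x]) → ∃ x ∈ N, φ.Realize a ![x]

/-- `B` is relatively `κ`-saturated in `A`: every type over a subset of `B` of size `< κ`
which is realized (by a finite tuple) in `A` is realized in `B`. -/
def RelKappaSaturated (κ : Cardinal.{u}) (B A : Set M) : Prop :=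
  B ⊆ A ∧
    ∀ S : Set M, S ⊆ B → #S < κ →
      ∀ (n : ℕ) (a : Fin n → M), (∀ i, a i ∈ A) →
        ∃ b : Fin n → M, (∀ i, b i ∈ B) ∧ SameTypeOver (L := L) S a b

/-- A subset `N ⊆ M` is `κ`-saturated (as a structure in its own right, computed inside
`M`): every set of formulas over `< κ` parameters from `N` which is finitely satisfiable
in `N` is realized in `N`. -/
def SubsetSaturated (κ : Cardinal.{u}) (N : Set M) : Prop :=
  ∀ S : Set M, S ⊆ N → #S < κ →
    ∀ p : Set (L.Formula (Fin 1 ⊕ ↥S)),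
      (∀ fs : Finset (L.Formula (Fin 1 ⊕ ↥S)), ↑fs ⊆ p →
        ∃ x ∈ N, ∀ φ ∈ fs, φ.Realize (Sum.elim ![x] Subtype.val)) →
      ∃ x ∈ N, ∀ φ ∈ p, φ.Realize (Sum.elim ![x] Subtype.val)

/-- `f` is a sequence of `m`-tuples which is indiscernible over `C`. -/
def IndiscOver (C : Set M) {m : ℕ} (f : ℕ → Fin m → M) : Prop :=
  ∀ (k : ℕ) (i j : Fin k → ℕ), StrictMono i → StrictMono j →
    SameTypeOver (L := L) C
      (fun s : Fin k × Fin m => f (i s.1) s.2) (fun s : Fin k × Fin m => f (j s.1) s.2)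

/-- The formula `φ(x̄, b)` divides over `C`: there is a `C`-indiscernible sequence starting
with `b` along which the instances of `φ` are `k`-inconsistent. -/
def Divides (C : Set M) {n m : ℕ} (φ : L.Formula (Fin n ⊕ Fin m)) (b : Fin m → M) : Prop :=
  ∃ f : ℕ → Fin m → M, f 0 = b ∧ IndiscOver (L := L) C f ∧
    ∃ k : ℕ, 0 < k ∧ ∀ i : Fin k → ℕ, StrictMono i →
      ¬ ∃ a : Fin n → M, ∀ j : Fin k, φ.Realize (Sum.elim a (f (i j)))

/-- `tp(a / B)` forks over `C`: the type implies a finite disjunction of formulas,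
each of which divides over `C`. -/
def TupForksOver {n : ℕ} (a : Fin n → M) (B C : Set M) : Prop :=
  ∃ (r : ℕ) (ms : Fin r → ℕ) (φ : ∀ i : Fin r, L.Formula (Fin n ⊕ Fin (ms i)))
    (b : ∀ i : Fin r, Fin (ms i) → M),
    (∀ i, Divides (L := L) C (φ i) (b i)) ∧
    ∀ a' : Fin n → M, SameTypeOver (L := L) B a a' →
      ∃ i, (φ i).Realize (Sum.elim a' (b i))

/-- The tuple `a` is independent from `X` over `C` (nonforking independence). -/
def TupIndepOver {n : ℕ} (a : Fin n → M) (X C : Set M) : Prop :=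
  ¬ TupForksOver (L := L) a (X ∪ C) C

/-- The set `Y` is independent from `X` over `C`: the type of every finite tuple from `Y`
over `X ∪ C` does not fork over `C`. -/
def IndepOver (Y X C : Set M) : Prop :=
  ∀ (n : ℕ) (a : Fin n → M), (∀ i, a i ∈ Y) → TupIndepOver (L := L) a X C

/-- `g` is an elementary map on the set `D`. -/
def ElemOn (D : Set M) (g : M → M) : Prop :=
  ∀ (n : ℕ) (a : Fin n → M), (∀ i, a i ∈ D) →
    SameTypeOver (L := L) (∅ : Set M) a (g ∘ a)

/-- The algebraic closure of `B` inside `M`. -/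
def aclSet (B : Set M) : Set M :=
  {x | ∃ φ : L.Formula (Fin 1 ⊕ ↥B), φ.Realize (Sum.elim ![x] Subtype.val) ∧
        {y : M | φ.Realize (Sum.elim ![y] Subtype.val)}.Finite}

/-- The type `tp(d / B)` is algebraic. -/
def AlgebraicTp (B : Set M) {n : ℕ} (d : Fin n → M) : Prop :=
  {d' : Fin n → M | SameTypeOver (L := L) B d d'}.Finite

/-- The types `tp(d / B)` and `tp(e / C)` are orthogonal: over any common extension `D`
of the domains, realizations of the respective nonforking extensions are independent. -/
def TypesOrthogonal {n m : ℕ} (B : Set M) (d : Fin n → M) (C : Set M) (e : Fin m → M) :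
    Prop :=
  ∀ (D : Set M) (d' : Fin n → M) (e' : Fin m → M), B ⊆ D → C ⊆ D →
    SameTypeOver (L := L) B d d' → ¬ TupForksOver (L := L) d' D B →
    SameTypeOver (L := L) C e e' → ¬ TupForksOver (L := L) e' D C →
    ¬ TupForksOver (L := L) d' (D ∪ Set.range e') D

/-- The type `tp(d / B)` is orthogonal to the set `A`: it is orthogonal to every complete
type over `acl(A)`. -/
def TypeOrthSet (B : Set M) {n : ℕ} (d : Fin n → M) (A : Set M) : Prop :=
  ∀ (m : ℕ) (e : Fin m → M), TypesOrthogonal (L := L) B d (aclSet (L := L) A) e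

/-- `tp(Na / Ma)` is orthogonal to the type `tp(e / Ma)`: the type over `Ma` of every
finite tuple from `Na` is orthogonal to it. -/
def SetTpOrth (Na Ma : Set M) {m : ℕ} (e : Fin m → M) : Prop :=
  ∀ (n : ℕ) (d : Fin n → M), (∀ i, d i ∈ Na) →
    TypesOrthogonal (L := L) Ma d Ma e

/-- The type `tp(d / B)` is regular: it is orthogonal to all of its forking extensions. -/
def TypeRegular (B : Set M) {n : ℕ} (d : Fin n → M) : Prop :=
  ∀ (D : Set M) (d' : Fin n → M), B ⊆ D →
    SameTypeOver (L := L) B d d' → TupForksOver (L := L) d' D B →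
    TypesOrthogonal (L := L) B d D d'

/-- The type `tp(d / B)` is stationary: it has a unique nonforking extension to every
superset of its domain. -/
def TypeStationary (B : Set M) {n : ℕ} (d : Fin n → M) : Prop :=
  ∀ D : Set M, B ⊆ D → ∀ d₁ d₂ : Fin n → M,
    SameTypeOver (L := L) B d d₁ → SameTypeOver (L := L) B d d₂ →
    ¬ TupForksOver (L := L) d₁ D B → ¬ TupForksOver (L := L) d₂ D B →
    SameTypeOver (L := L) D d₁ d₂

/-- `D` is `κ`-atomic over `B`: the type of every finite tuple from `D` over `B` is
implied by its restriction to a subset of `B` of size `< κ`. -/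
def KappaAtomicOver (κ : Cardinal.{u}) (D B : Set M) : Prop :=
  ∀ (n : ℕ) (d : Fin n → M), (∀ i, d i ∈ D) →
    ∃ S : Set M, S ⊆ B ∧ #S < κ ∧
      ∀ d' : Fin n → M, SameTypeOver (L := L) S d d' → SameTypeOver (L := L) B d d'

/-- `N` is `κ`-prime over `X`: `N` is a `κ`-saturated elementary substructure containing
`X` which elementarily embeds over `X` into every `κ`-saturated elementary substructure
containing `X`. -/
def KappaPrimeOver (κ : Cardinal.{u}) (N X : Set M) : Prop :=
  ElemSubset (L := L) N ∧ X ⊆ N ∧ SubsetSaturated (L := L) κ N ∧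
    ∀ N' : Set M, ElemSubset (L := L) N' → X ⊆ N' → SubsetSaturated (L := L) κ N' →
      ∃ g : M → M, ElemOn (L := L) N g ∧ (∀ x ∈ X, g x = x) ∧ g '' N ⊆ N'

/-- `Ma` is `A`-full in `M`. -/
def AFull (A Ma : Set M) (κ : Cardinal.{u}) : Prop :=
  ∀ N : Set M, KappaPrimeOver (L := L) κ N (Ma ∪ A) →
    ∀ C0 C1 C2 : Set M, C0 ⊆ Ma → C1 ⊆ A → C0 ⊆ C2 → C1 ⊆ C2 → C2 ⊆ N →
      #C0 ≤ cardL L → #C1 ≤ cardL L → #C2 ≤ cardL L →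
      ∃ f : M → M, ElemOn (L := L) (C1 ∪ C2) f ∧ (∀ x ∈ C0, f x = x) ∧
        f '' (C1 ∪ C2) ⊆ Ma ∧ f '' C1 ⊆ A ∧
        (IndepOver (L := L) C2 A C1 → IndepOver (L := L) (f '' C2) A (f '' C1))

/-- `(M₁, A₁) ∈ K_c`. -/
structure Kc (κ : Cardinal.{u}) (A : Set M) (c : M) (M₁ A₁ : Set M) : Prop where
  elem : ElemSubset (L := L) M₁
  mem : c ∈ M₁
  relSat : RelKappaSaturated (L := L) κ A₁ A
  sub : A₁ ⊆ M₁
  indep : IndepOver (L := L) M₁ A A₁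
  cardA₁ : #A₁ ≤ κ
  cardM₁ : #M₁ ≤ κ
  sat : SubsetSaturated (L := L) κ M₁

/-- `⟨A₁, Ma, Mb, Na, g⟩ ∈ K¹_{a,b}`. -/
structure K1 (κ : Cardinal.{u}) (A : Set M) (a b : M) (A₁ Ma Mb Na : Set M)
    (g : M → M) : Prop where
  ka : Kc (L := L) κ A a Ma A₁
  kb : Kc (L := L) κ A b Mb A₁
  gBij : Set.BijOn g Ma Mb
  gFix : ∀ x ∈ A₁, g x = x
  gElem : ElemOn (L := L) Ma g
  gab : g a = b
  sub : Ma ⊆ Na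
  elemNa : ElemSubset (L := L) Na
  satNa : SubsetSaturated (L := L) κ Na
  cardNa : #Na = κ
  indepNa : IndepOver (L := L) Na A A₁

/-- `⟨A₁, Ma, Mb, Na, g⟩ ∈ K²_{a,b}`: additionally `g` is an isomorphism of `Ma^eq` onto
`Mb^eq` over `A₁^eq`, i.e. `g` preserves strong types over `A₁`. -/
def K2 (κ : Cardinal.{u}) (A : Set M) (a b : M) (A₁ Ma Mb Na : Set M)
    (g : M → M) : Prop :=
  K1 (L := L) κ A a b A₁ Ma Mb Na g ∧
    ∀ (n : ℕ) (t : Fin n → M), (∀ i, t i ∈ Ma) →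
      SameStrongTypeOver (L := L) A₁ t (g ∘ t)

/-- `K^i_{a,b}` for `i ∈ {1,2}` (`two = false` gives `K¹`, `two = true` gives `K²`). -/
def Ki (two : Bool) (κ : Cardinal.{u}) (A : Set M) (a b : M) (A₁ Ma Mb Na : Set M)
    (g : M → M) : Prop :=
  if two then K2 (L := L) κ A a b A₁ Ma Mb Na g
  else K1 (L := L) κ A a b A₁ Ma Mb Na g

/-- `d'` realizes `g(tp(d / Ma))`. -/
def RealizesGType (Ma : Set M) (g : M → M) {n : ℕ} (d d' : Fin n → M) : Prop :=
  ∀ (k : ℕ) (m : Fin k → M), (∀ i, m i ∈ Ma) →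
    ∀ φ : L.Formula (Fin n ⊕ Fin k),
      φ.Realize (Sum.elim d m) ↔ φ.Realize (Sum.elim d' (g ∘ m))

/-- The data `⟨A₁, Ma, Mb, Na, g⟩ ∈ K²_{a,b}` satisfies the conclusion of the
characterization of failure of weak benignity (conditions (a)–(f) of the main lemma). -/
structure CharWitness (κ : Cardinal.{u}) (A : Set M) (a b : M) (Astar Ma Mb Na : Set M)
    (g : M → M) : Prop where
  k2 : K2 (L := L) κ A a b Astar Ma Mb Na g
  ne : Ma ≠ Na
  full : AFull (L := L) A Ma κ
  indepNa : IndepOver (L := L) Na A Astar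
  orth : ∀ (n : ℕ) (e : Fin n → M), ¬ AlgebraicTp (L := L) Ma e →
    TypeOrthSet (L := L) Ma e A → SetTpOrth (L := L) Na Ma e
  noCopy : ∀ (n : ℕ) (d : Fin n → M), (∀ i, d i ∈ Na) → ¬ (∀ i, d i ∈ Ma) →
    ¬ ∃ d' : Fin n → M, RealizesGType (L := L) Ma g d d' ∧
        TupIndepOver (L := L) d' A Mb
  gStrong : ∀ (n : ℕ) (t : Fin n → M), (∀ i, t i ∈ Ma) →
    SameStrongTypeOver (L := L) Astar t (g ∘ t)

/-- An `L*`-elementary map from `(M, A)` to `(M', A')`. -/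
def LstarElementary {M' : Type u} [L.Structure M'] (A : Set M) (A' : Set M')
    (h : M → M') : Prop :=
  ∀ (n : ℕ) (φ : (L.sum unaryLang).Formula (Fin n)) (v : Fin n → M),
    (letI : unaryLang.Structure M := unaryStructure A; φ.Realize v) ↔
    (letI : unaryLang.Structure M' := unaryStructure A'; φ.Realize (h ∘ v))

/-- The family `I` of tuples is independent over `Y`: each member is independent over `Y`
from the union of the other members. -/
def IndepFamily (Y : Set M) (I : Set (Σ m : ℕ, Fin m → M)) : Prop :=
  ∀ t ∈ I, TupIndepOver (L := L) t.2 (⋃ s ∈ I \ {t}, Set.range s.2) Y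

/-- `tp(t / Y)` belongs to the family `P` of regular stationary types nonorthogonal to
`p* = tp(dstar / Pbase)`. -/
def InP {nd : ℕ} (Pbase : Set M) (dstar : Fin nd → M) {m : ℕ} (Y : Set M)
    (t : Fin m → M) : Prop :=
  TypeRegular (L := L) Y t ∧ TypeStationary (L := L) Y t ∧
    ¬ TypesOrthogonal (L := L) Y t Pbase dstar

/-- The `P`-weight `w_P(X, Y)` of the set `X` over the set `Y`, where
`P = {p : p regular, stationary, nonorthogonal to p* = tp(dstar / Pbase)}`: the supremum
of cardinalities of `Y`-independent families of tuples realizing types in `P` over `Y`,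
each of which forks with `X` over `Y`. -/
noncomputable def wP {nd : ℕ} (Pbase : Set M) (dstar : Fin nd → M) (X Y : Set M) :
    Cardinal.{u} :=
  sSup { c : Cardinal.{u} | ∃ I : Set (Σ m : ℕ, Fin m → M), #I = c ∧
    IndepFamily (L := L) Y I ∧
    ∀ t ∈ I, InP (L := L) Pbase dstar Y t.2 ∧
      TupForksOver (L := L) t.2 (Y ∪ X) Y }

/-- The set of realizations in `X` of the (1-)type `tp(e / B)`. -/
def qSet (B : Set M) (e : M) (X : Set M) : Set M :=
  {x ∈ X | SameTypeOver (L := L) B ![x] ![e]}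

/-- `dim(tp(d / B), N)` is finite: there is no infinite sequence of realizations of the
type in `N`, chosen successively independent. -/
def DimFinite (B : Set M) {n : ℕ} (d : Fin n → M) (N : Set M) : Prop :=
  ¬ ∃ f : ℕ → Fin n → M,
    ∀ j : ℕ, (∀ i, f j i ∈ N) ∧ SameTypeOver (L := L) B d (f j) ∧
      ¬ TupForksOver (L := L) (f j) (B ∪ ⋃ l ∈ Set.Iio j, Set.range (f l)) B

/-- The definable subsets (with parameters) of `N^n`. -/
def DefSet (N : Type u) [L.Structure N] (n : ℕ) : Set (Set (Fin n → N)) :=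
  {X | ∃ (m : ℕ) (φ : L.Formula (Fin n ⊕ Fin m)) (b : Fin m → N),
    X = {v | φ.Realize (Sum.elim v b)}}

/-- The Morley rank of the (definable) set `X` is at least `α`. -/
def MRge {N : Type u} [L.Structure N] {n : ℕ} (X : Set (Fin n → N)) (α : Ordinal.{u}) :
    Prop :=
  X.Nonempty ∧ ∀ β, β < α → ∃ f : ℕ → Set (Fin n → N),
    (∀ i, f i ∈ DefSet (L := L) N n ∧ f i ⊆ X ∧ MRge (f i) β) ∧
    Pairwise (Function.onFun Disjoint f)
termination_by α
decreasing_by exact ‹β < α›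

/-- The theory `T` has Morley rank `2`: in every `ℵ₀`-saturated model, the rank of the
whole universe (in one variable) is exactly `2`. -/
def MorleyRankTwo (L : FirstOrder.Language.{u, u}) (T : L.Theory) : Prop :=
  ∀ (N : Type u) (_ : L.Structure N), N ⊨ T → SaturatedIn (M := N) L ℵ₀ →
    MRge (L := L) (Set.univ : Set (Fin 1 → N)) 2 ∧
      ¬ MRge (L := L) (Set.univ : Set (Fin 1 → N)) 3

/-- `T` has NDOP: in any sufficiently saturated model, for elementary substructures
`N₁, N₂` independent over a common elementary substructure `N₀`, and `N₃` prime over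
`N₁ ∪ N₂`, every nonalgebraic type over `N₃` is nonorthogonal to `N₁` or to `N₂`. -/
def NDOP (L : FirstOrder.Language.{u, u}) (T : L.Theory) : Prop :=
  ∀ (N : Type u) (_ : L.Structure N), N ⊨ T →
    SaturatedIn (M := N) L (Order.succ ℵ₀) →
    ∀ N₀ N₁ N₂ N₃ : Set N,
      ElemSubset (L := L) N₀ → ElemSubset (L := L) N₁ → ElemSubset (L := L) N₂ →
      N₀ ⊆ N₁ → N₀ ⊆ N₂ → IndepOver (L := L) N₁ N₂ N₀ →
      KappaPrimeOver (L := L) ℵ₀ N₃ (N₁ ∪ N₂) →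
      ∀ (n : ℕ) (d : Fin n → N), ¬ AlgebraicTp (L := L) N₃ d →
        ¬ TypeOrthSet (L := L) N₃ d N₁ ∨ ¬ TypeOrthSet (L := L) N₃ d N₂

/-- `X` supports a complete binary splitting tree of height `m` whose nodes are labelled by
members of `F`. -/
def SplitTree {α : Type*} (F : Set (Set α)) : ℕ → Set α → Prop
  | 0, X => X.Nonempty
  | m + 1, X => ∃ Y ∈ F, SplitTree F m (X ∩ Y) ∧ SplitTree F m (X \ Y)

/-- The cell cut out by the family `Y` according to the pattern `I`. -/
def patternCell {α ι : Type*} (Y : ι → Set α) (I : Set ι) : Set α :=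
  {x | ∀ j, x ∈ Y j ↔ j ∈ I}

/-- A finitary Cantor–Bendixson rank: `X` has rank at least `m`, with branching `N`, with
respect to the cells of finite subfamilies of `F`. -/
def Large {α : Type*} (F : Set (Set α)) (N : ℕ) : ℕ → Set α → Prop
  | 0, X => X.Nonempty
  | m + 1, X => ∃ (q : ℕ) (Y : Fin q → Set α) (I : Fin N → Set (Fin q)),
      (∀ j, Y j ∈ F) ∧ Function.Injective I ∧ ∀ i, Large F N m (X ∩ patternCell Y (I i))

section Combinatorics

variable {α : Type*} {F : Set (Set α)}

theorem SplitTree.mono {m : ℕ} {X X' : Set α} (hX : X ⊆ X') (h : SplitTree F m X) :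
    SplitTree F m X' := by
  induction m generalizing X X' with
  | zero => exact Set.Nonempty.mono hX h
  | succ m ih =>
    obtain ⟨Y, hY, h1, h2⟩ := h
    exact ⟨Y, hY, ih (Set.inter_subset_inter_left _ hX) h1,
      ih (Set.sdiff_subset_sdiff_left hX) h2⟩

theorem SplitTree.nonempty {m : ℕ} {X : Set α} (h : SplitTree F m X) : X.Nonempty := by
  induction m generalizing X with
  | zero => exact h
  | succ m ih =>
    obtain ⟨Y, -, h1, -⟩ := h
    exact (ih h1).mono Set.inter_subset_left

theorem SplitTree.exists_of_iUnion {ι : Type*} [Fintype ι] [Nonempty ι] {G : ι → Set (Set α)}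
    {s : ℕ} (a : ι → ℕ) (ha : ∑ i, a i = s) {X : Set α} (h : SplitTree (⋃ i, G i) s X) :
    ∃ i, SplitTree (G i) (a i) X := by
  classical
  induction s generalizing a X with
  | zero =>
    obtain ⟨i⟩ := ‹Nonempty ι›
    have : a i = 0 := by
      have := Finset.sum_eq_zero_iff.1 ha i (Finset.mem_univ i)
      exact this
    exact ⟨i, by rw [this]; exact h⟩
  | succ s ih =>
    obtain ⟨Y, hY, h1, h2⟩ := h
    obtain ⟨l, hl⟩ := Set.mem_iUnion.1 hY
    rcases Nat.eq_zero_or_pos (a l) with h0 | hpos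
    · refine ⟨l, ?_⟩
      rw [h0]
      exact h1.nonempty.mono Set.inter_subset_left
    · have hsum : ∑ i, Function.update a l (a l - 1) i = s := by
        rw [Finset.sum_update_of_mem (Finset.mem_univ l)]
        rw [Finset.sum_eq_add_sum_sdiff_singleton_of_mem (Finset.mem_univ l)] at ha
        omega
      obtain ⟨i, hi⟩ := ih _ hsum h1
      obtain ⟨j, hj⟩ := ih _ hsum h2
      by_cases hil : i = l
      · by_cases hjl : j = l
        · subst hil
          subst hjl
          rw [Function.update_self] at hi hj
          refine ⟨j, ?_⟩
          obtain ⟨t, ht⟩ := Nat.exists_eq_succ_of_ne_zero hpos.ne'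
          rw [ht] at hi hj ⊢
          exact ⟨Y, hl, hi, hj⟩
        · rw [Function.update_of_ne hjl] at hj
          exact ⟨j, hj.mono Set.sdiff_subset⟩
      · rw [Function.update_of_ne hil] at hi
        exact ⟨i, hi.mono Set.inter_subset_left⟩

theorem Large.mono {N m : ℕ} {X X' : Set α} (hX : X ⊆ X') (h : Large F N m X) :
    Large F N m X' := by
  induction m generalizing X X' with
  | zero => exact Set.Nonempty.mono hX h
  | succ m ih =>
    obtain ⟨q, Y, I, hY, hI, h⟩ := h
    exact ⟨q, Y, I, hY, hI, fun i => ih (Set.inter_subset_inter_left _ hX) (h i)⟩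

theorem Large.anti {N N' m : ℕ} {X : Set α} (hN : N' ≤ N) (h : Large F N m X) :
    Large F N' m X := by
  induction m generalizing X with
  | zero => exact h
  | succ m ih =>
    obtain ⟨q, Y, I, hY, hI, h⟩ := h
    exact ⟨q, Y, I ∘ Fin.castLE hN, hY, hI.comp (Fin.castLE_injective hN), fun i => ih (h _)⟩

theorem Large.nonempty {N m : ℕ} (hN : 0 < N) {X : Set α} (h : Large F N m X) :
    X.Nonempty := by
  induction m generalizing X with
  | zero => exact h
  | succ m ih =>
    obtain ⟨q, Y, I, -, -, h⟩ := h
    exact (ih (h ⟨0, hN⟩)).mono Set.inter_subset_left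

theorem Large.splitTree {m : ℕ} {X : Set α} (h : Large F 2 m X) : SplitTree F m X := by
  induction m generalizing X with
  | zero => exact h
  | succ m ih =>
    obtain ⟨q, Y, I, hY, hI, h⟩ := h
    have key : ∀ i i' : Fin 2, ∀ j, j ∈ I i → j ∉ I i' → SplitTree F (m + 1) X := by
      intro i i' j hi hi'
      refine ⟨Y j, hY j, (ih (h i)).mono ?_, (ih (h i')).mono ?_⟩
      · exact fun x hx => ⟨hx.1, (hx.2 j).2 hi⟩
      · exact fun x hx => ⟨hx.1, fun hxj => hi' ((hx.2 j).1 hxj)⟩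
    have hne : I 0 ≠ I 1 := fun hh => by simpa using hI hh
    by_cases hsub : I 0 ⊆ I 1
    · have hsub' : ¬ I 1 ⊆ I 0 := fun hh => hne (hsub.antisymm hh)
      obtain ⟨j, h1, h0⟩ := Set.not_subset.1 hsub'
      exact key 1 0 j h1 h0
    · obtain ⟨j, h0, h1⟩ := Set.not_subset.1 hsub
      exact key 0 1 j h0 h1

theorem Large.exists_of_iUnion {ι : Type*} [Fintype ι] [Nonempty ι] {N m : ℕ}
    {X : ι → Set α} (h : Large F (Fintype.card ι * N) m (⋃ i, X i)) :
    ∃ i, Large F N m (X i) := by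
  classical
  induction m generalizing X with
  | zero =>
    obtain ⟨x, hx⟩ := h
    obtain ⟨i, hi⟩ := Set.mem_iUnion.1 hx
    exact ⟨i, x, hi⟩
  | succ m ih =>
    obtain ⟨q, Y, I, hY, hI, h⟩ := h
    have h' : ∀ i, ∃ l, Large F N m (X l ∩ patternCell Y (I i)) := by
      intro i
      have := h i
      rw [Set.iUnion_inter] at this
      exact ih this
    choose l hl using h'
    obtain ⟨y, hy⟩ := Fintype.exists_le_card_fiber_of_mul_le_card l
      (n := N) (by simp)
    obtain ⟨e⟩ : Nonempty (Fin N ↪ {x // x ∈ Finset.univ.filter fun x => l x = y}) :=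
      Function.Embedding.nonempty_of_card_le (by rwa [Fintype.card_fin, Fintype.card_coe])
    refine ⟨y, q, Y, fun i => I (e i), hY, hI.comp (Subtype.val_injective.comp e.injective), ?_⟩
    intro i
    have := (Finset.mem_filter.1 (e i).2).2
    have h2 := hl (e i)
    rwa [this] at h2

theorem exists_large_of_iUnion {ι : Type*} [Fintype ι] [Nonempty ι] {m : ℕ}
    {X : ι → Set α} (h : ∀ N, Large F N m (⋃ i, X i)) :
    ∃ i, ∀ N, Large F N m (X i) := by
  by_contra! hcon
  choose N hN using hcon
  obtain ⟨i, hi⟩ := Large.exists_of_iUnion (h (Fintype.card ι * Finset.univ.sup N))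
  exact hN i (hi.anti (Finset.le_sup (Finset.mem_univ i)))

/-- Infinitely many uniformly large, `k`-inconsistent members of `F` raise the rank. -/
theorem large_succ_of_inconsistent {X : Set α} {Z : ℕ → Set α} (hZ : ∀ j, Z j ∈ F) {k m : ℕ}
    (hk : ∀ s : Finset ℕ, s.card = k → ∀ x ∈ X, ∃ j ∈ s, x ∉ Z j)
    (hlarge : ∀ j N, Large F N m (X ∩ Z j)) (N : ℕ) : Large F N (m + 1) X := by
  classical
  suffices ∀ N, 0 < N → Large F N (m + 1) X from (this (N + 1) N.succ_pos).anti N.le_succ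
  clear N
  intro N hN
  have hk0 : 0 < k := by
    rcases Nat.eq_zero_or_pos k with rfl | h
    · obtain ⟨x, hx⟩ := (hlarge 0 1).nonempty one_pos
      obtain ⟨j, hj, -⟩ := hk ∅ rfl x hx.1
      simp at hj
    · exact h
  let Y : Fin (k * N) → Set α := fun j => Z j
  have hI : ∀ j : Fin (k * N), ∃ I : Finset (Fin (k * N)),
      Large F N m (X ∩ Z j ∩ patternCell Y (I : Set (Fin (k * N)))) := by
    intro j
    refine Large.exists_of_iUnion ((hlarge j _).mono ?_)
    intro x hx
    refine Set.mem_iUnion.2 ⟨Finset.univ.filter fun i => x ∈ Y i, hx, ?_⟩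
    intro i
    simp
  choose I hI using hI
  have hmem : ∀ j, j ∈ I j := by
    intro j
    obtain ⟨x, hx⟩ := (hI j).nonempty hN
    exact_mod_cast (hx.2 j).1 hx.1.2
  have hcard : ∀ j, (I j).card ≤ k := by
    intro j
    by_contra! hlt
    obtain ⟨s, hs, hsk⟩ := Finset.exists_subset_card_eq hlt.le
    obtain ⟨x, hx⟩ := (hI j).nonempty hN
    obtain ⟨i, hi, hxi⟩ := hk (s.map Fin.valEmbedding) (by simpa using hsk) x hx.1.1
    obtain ⟨i', hi', rfl⟩ := Finset.mem_map.1 hi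
    exact hxi ((hx.2 i').2 (hs hi'))
  have himg : N ≤ (Finset.univ.image I).card := by
    have := Finset.card_le_mul_card_image (f := I) Finset.univ k (by
      intro J hJ
      obtain ⟨j, -, rfl⟩ := Finset.mem_image.1 hJ
      refine le_trans (Finset.card_le_card ?_) (hcard j)
      intro i hi
      rw [← (Finset.mem_filter.1 hi).2]
      exact hmem i)
    rw [Finset.card_univ, Fintype.card_fin] at this
    exact Nat.le_of_mul_le_mul_left this hk0
  obtain ⟨e⟩ : Nonempty (Fin N ↪ {x // x ∈ Finset.univ.image I}) :=
    Function.Embedding.nonempty_of_card_le (by rwa [Fintype.card_fin, Fintype.card_coe])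
  refine ⟨k * N, Y, fun i => ((e i : Finset (Fin (k * N))) : Set (Fin (k * N))),
    fun j => hZ j, ?_, ?_⟩
  · intro i i' h
    exact e.injective (Subtype.ext (Finset.coe_injective h))
  · intro i
    obtain ⟨j, -, hj⟩ := Finset.mem_image.1 (e i).2
    simp only [← hj]
    refine (hI j).mono ?_
    rintro x ⟨⟨hx, -⟩, hx2⟩
    exact ⟨hx, hx2⟩

end Combinatorics

/-- A splitting tree of height `P.card` yields elements indexed by all subsets of `W`, and
parameters indexed by the initial segments of those subsets, which exhibit the prescribed
memberships along `P`. -/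
theorem SplitTree.exists_paths {α β W : Type*} [LinearOrder W] [Nonempty β] {R : β → Set α}
    (P : Finset W) {X : Set α} (h : SplitTree (Set.range R) P.card X) :
    ∃ (x : Set W → α) (y : (Σ w : W, Set (Set.Iio w)) → β), ∀ η : Set W, x η ∈ X ∧
      ∀ w ∈ P, (x η ∈ R (y ⟨w, Subtype.val ⁻¹' η⟩) ↔ w ∈ η) := by
  classical
  induction P using Finset.induction_on_min generalizing X with
  | empty =>
    obtain ⟨a, ha⟩ := h
    exact ⟨fun _ => a, fun _ => Classical.arbitrary β, fun _ => ⟨ha, by simp⟩⟩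
  | insert w₀ P hP ih =>
    have hw₀ : w₀ ∉ P := fun hh => lt_irrefl _ (hP w₀ hh)
    rw [Finset.card_insert_of_notMem hw₀] at h
    obtain ⟨_, ⟨b, rfl⟩, h1, h2⟩ := h
    obtain ⟨x1, y1, hxy1⟩ := ih h1
    obtain ⟨x2, y2, hxy2⟩ := ih h2
    refine ⟨fun η => if w₀ ∈ η then x1 η else x2 η, fun p =>
      if h : w₀ < p.1 then (if (⟨w₀, h⟩ : Set.Iio p.1) ∈ p.2 then y1 p else y2 p) else b,
      fun η => ⟨?_, ?_⟩⟩
    · by_cases hη : w₀ ∈ η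
      · simpa [hη] using (hxy1 η).1.1
      · simpa [hη] using (hxy2 η).1.1
    · intro w hw
      rcases Finset.mem_insert.1 hw with rfl | hw
      · by_cases hη : w ∈ η
        · simpa [hη] using (hxy1 η).1.2
        · simpa [hη] using (hxy2 η).1.2
      · have hlt := hP w hw
        by_cases hη : w₀ ∈ η
        · simpa [hη, hlt] using (hxy1 η).2 w hw
        · simpa [hη, hlt] using (hxy2 η).2 w hw

/-- The family of all instances of a formula. -/
def instanceFamily {L : FirstOrder.Language.{u, u}} {M : Type u} [L.Structure M] {n k : ℕ}
    (φ : L.Formula (Fin n ⊕ Fin k)) : Set (Set (Fin n → M)) :=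
  Set.range fun b : Fin k → M => {x | φ.Realize (Sum.elim x b)}

theorem exists_ne_of_splitTree {M : Type*} {n : ℕ} {F : Set (Set (Fin n → M))}
    (h : SplitTree F 1 Set.univ) : ∃ a b : M, a ≠ b := by
  obtain ⟨Y, -, ⟨x, -, hx⟩, ⟨x', -, hx'⟩⟩ := h
  have : x ≠ x' := fun hh => hx' (hh ▸ hx)
  obtain ⟨i, hi⟩ := Function.ne_iff.1 this
  exact ⟨_, _, hi⟩

theorem typeOf_ne_of_realize {L' : FirstOrder.Language} {M : Type*} [L'.Structure M]
    [Nonempty M] {T : L'.Theory} [M ⊨ T] {α : Type*} {v w : α → M} (φ : L'.Formula α)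
    (hv : φ.Realize v) (hw : ¬ φ.Realize w) : T.typeOf v ≠ T.typeOf w := by
  intro h
  apply hw
  rw [← Theory.CompleteType.formula_mem_typeOf (T := T), ← h,
    Theory.CompleteType.formula_mem_typeOf]
  exact hv

theorem not_stableIn_of_lt_aleph0 {L : FirstOrder.Language.{u, u}} {M : Type u} [L.Structure M]
    {a b : M} (hab : a ≠ b) {κ : Cardinal.{u}} (hκ : κ < ℵ₀) :
    ¬ StableIn L (L.completeTheory M) κ := by
  classical
  intro hst
  obtain ⟨c, rfl⟩ := Cardinal.lt_aleph0.1 hκ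
  have : Nonempty M := ⟨a⟩
  have hle := hst M inferInstance inferInstance ∅ (by simp) (c + 1)
  let v : Fin (c + 1) → Fin (c + 1) → M := fun j i => if i ≤ j then a else b
  have hinj : Function.Injective fun j : ULift.{u} (Fin (c + 1)) =>
      (L[[↥(∅ : Set M)]].completeTheory M).typeOf (v j.down) := by
    have key : ∀ j j' : Fin (c + 1), j < j' →
        (L[[↥(∅ : Set M)]].completeTheory M).typeOf (v j') ≠
          (L[[↥(∅ : Set M)]].completeTheory M).typeOf (v j) := by
      intro j j' hlt
      refine typeOf_ne_of_realize (Term.equal (Term.var 0) (Term.var j')) ?_ ?_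
      · simp [v]
      · simpa [v, hlt.not_ge] using hab
    intro j j' h
    rcases lt_trichotomy j.down j'.down with hlt | heq | hlt
    · exact absurd h.symm (key _ _ hlt)
    · exact ULift.down_injective heq
    · exact absurd h (key _ _ hlt)
  have := (Cardinal.mk_le_of_injective hinj).trans hle
  simp only [mk_uLift, mk_fin, lift_natCast] at this
  have := Nat.cast_le.1 this
  omega

theorem not_stableIn_of_aleph0_le {L : FirstOrder.Language.{u, u}} {M : Type u} [L.Structure M]
    {n k : ℕ} (φ : L.Formula (Fin n ⊕ Fin k))
    (h : ∀ m, SplitTree (instanceFamily (M := M) φ) m Set.univ) {κ : Cardinal.{u}}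
    (hκ : ℵ₀ ≤ κ) : ¬ StableIn L (L.completeTheory M) κ := by
  classical
  intro hst
  obtain ⟨a₀, -, -⟩ := exists_ne_of_splitTree (h 1)
  have : Nonempty M := ⟨a₀⟩
  let μ : Cardinal.{u} := sInf {c | κ < 2 ^ c}
  have hμ : κ < 2 ^ μ := csInf_mem (s := {c : Cardinal.{u} | κ < 2 ^ c}) ⟨κ, cantor κ⟩
  have hμκ : μ ≤ κ := csInf_le' (cantor κ)
  have hμlt : ∀ c < μ, 2 ^ c ≤ κ := fun c hc => by
    by_contra hlt
    exact (csInf_le' (s := {c : Cardinal.{u} | κ < 2 ^ c}) (not_le.1 hlt)).not_gt hc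
  let W : Type u := μ.ord.ToType
  let Node : Type u := Σ w : W, Set (Set.Iio w)
  have hW : #W = μ := mk_ord_toType μ
  have hNode : #Node ≤ κ := by
    rw [mk_sigma]
    refine (sum_le_sum _ (fun _ => κ) fun w => ?_).trans ?_
    · rw [mk_set]
      exact hμlt _ ((mk_Iio_lt w (by simp [W])).trans_eq hW)
    · rw [sum_const', hW]
      exact mul_le_of_le hκ hμκ le_rfl
  choose x y hxy using fun P : Finset W => SplitTree.exists_paths P (h P.card)
  let U : Ultrafilter (Finset W) := Ultrafilter.of Filter.atTop
  let N : Type u := (U : Filter (Finset W)).Product fun _ => M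
  let xN : Set W → Fin n → N := fun η i => ((fun P => x P η i : Finset W → M) : N)
  let yN : Node → Fin k → N := fun p i => ((fun P => y P p i : Finset W → M) : N)
  have hN : N ⊨ L.completeTheory M := by
    refine ⟨fun ψ hψ => ?_⟩
    rw [Ultraproduct.sentence_realize]
    exact Filter.Eventually.of_forall fun _ => hψ
  have hφ : ∀ (η : Set W) (w : W),
      φ.Realize (Sum.elim (xN η) (yN ⟨w, Subtype.val ⁻¹' η⟩)) ↔ w ∈ η := by
    intro η w
    have h1 : (Sum.elim (xN η) (yN ⟨w, Subtype.val ⁻¹' η⟩) : Fin n ⊕ Fin k → N) =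
        fun i => ((fun P => Sum.elim (x P η) (y P ⟨w, Subtype.val ⁻¹' η⟩) i :
          Finset W → M) : N) := by
      funext i
      cases i <;> rfl
    have hcast := Ultraproduct.realize_formula_cast (u := U) (M := fun _ => M) φ
      fun i P => Sum.elim (x P η) (y P ⟨w, Subtype.val ⁻¹' η⟩) i
    refine (iff_of_eq (congrArg φ.Realize h1)).trans (hcast.trans ?_)
    have h2 : ∀ᶠ P in (U : Filter (Finset W)),
        (φ.Realize (fun i => Sum.elim (x P η) (y P ⟨w, Subtype.val ⁻¹' η⟩) i) ↔ w ∈ η) := by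
      refine Filter.Eventually.filter_mono (Ultrafilter.of_le Filter.atTop) ?_
      filter_upwards [Filter.eventually_ge_atTop {w}] with P hP
      exact (hxy P η).2 w (hP (Finset.mem_singleton_self w))
    rw [Filter.eventually_congr h2]
    exact Filter.eventually_const
  let A : Set N := Set.range fun p : Node × Fin k => yN p.1 p.2
  have hA : #A ≤ κ := by
    refine mk_range_le.trans ?_
    rw [mk_prod, lift_uzero]
    refine mul_le_of_le hκ hNode ?_
    simp only [mk_fin, lift_natCast]
    exact (natCast_lt_aleph0.le).trans hκ
  have hle := hst N inferInstance hN A hA n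
  have hinj : Function.Injective fun η : Set W =>
      (L[[↥A]].completeTheory N).typeOf (xN η) := by
    have key : ∀ (η η' : Set W) (w : W), (∀ v < w, v ∈ η ↔ v ∈ η') → w ∈ η → w ∉ η' →
        (L[[↥A]].completeTheory N).typeOf (xN η) ≠
          (L[[↥A]].completeTheory N).typeOf (xN η') := by
      intro η η' w hlt hw hw'
      have hres : (Subtype.val ⁻¹' η : Set (Set.Iio w)) = Subtype.val ⁻¹' η' := by
        ext v
        exact hlt v v.2
      let p : Node := ⟨w, Subtype.val ⁻¹' η⟩
      let ψ : L[[↥A]].Formula (Fin n) := BoundedFormula.constantsVarsEquiv.symm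
        (φ.relabel (Sum.elim Sum.inr fun i => Sum.inl (⟨yN p i, (p, i), rfl⟩ : A)))
      have hψ : ∀ z : Fin n → N, ψ.Realize z ↔ φ.Realize (Sum.elim z (yN p)) := by
        intro z
        unfold Formula.Realize
        rw [← BoundedFormula.realize_constantsVarsEquiv, Equiv.apply_symm_apply]
        refine Formula.realize_relabel.trans ?_
        have : (Sum.elim (fun a : A => ((L.con a : L[[↥A]].Constants) : N)) z ∘
            Sum.elim Sum.inr fun i => Sum.inl (⟨yN p i, (p, i), rfl⟩ : A)) =
            Sum.elim z (yN p) := by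
          funext i
          cases i <;> simp
        rw [this]
        rfl
      refine typeOf_ne_of_realize ψ ((hψ _).2 ((hφ η w).2 hw)) fun hh => hw' ?_
      have := (hψ _).1 hh
      rw [← hφ η' w, ← hres]
      exact this
    intro η η' heq
    by_contra hne
    have hne' : {w | ¬ (w ∈ η ↔ w ∈ η')}.Nonempty := by
      by_contra hemp
      rw [Set.not_nonempty_iff_eq_empty] at hemp
      refine hne (Set.ext fun w => ?_)
      by_contra hw
      exact (hemp ▸ hw : w ∈ (∅ : Set W))
    obtain ⟨w, hw, hmin⟩ := WellFounded.has_min (wellFounded_lt (α := W)) _ hne'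
    have hlt : ∀ v < w, v ∈ η ↔ v ∈ η' := fun v hv => not_not.1 fun hh => hmin v hh hv
    by_cases hwη : w ∈ η
    · exact key η η' w hlt hwη (fun hh => hw ⟨fun _ => hh, fun _ => hwη⟩) heq
    · have hwη' : w ∈ η' := by
        by_contra hh
        exact hw ⟨fun h => absurd h hwη, fun h => absurd h hh⟩
      exact key η' η w (fun v hv => (hlt v hv).symm) hwη' hwη heq.symm
  have := (Cardinal.mk_le_of_injective hinj).trans hle
  rw [mk_set, hW] at this
  exact this.not_gt hμ

theorem not_stable_of_splitTree {L : FirstOrder.Language.{u, u}} {M : Type u} [L.Structure M]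
    {n k : ℕ} (φ : L.Formula (Fin n ⊕ Fin k))
    (h : ∀ m, SplitTree (instanceFamily (M := M) φ) m Set.univ) :
    ¬ Stable L (L.completeTheory M) := by
  rintro ⟨κ, hst⟩
  rcases lt_or_ge κ ℵ₀ with hκ | hκ
  · obtain ⟨a, b, hab⟩ := exists_ne_of_splitTree (h 1)
    exact not_stableIn_of_lt_aleph0 hab hκ hst
  · exact not_stableIn_of_aleph0_le φ h hκ hst

section Saturation

variable {L : FirstOrder.Language.{u, u}} {M : Type u} [L.Structure M]

/-- Two families of elements have the same type over the empty set. -/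
def Equitype (L : FirstOrder.Language.{u, u}) {M : Type u} [L.Structure M] {γ : Type*}
    (c c' : γ → M) : Prop :=
  ∀ χ : L.Formula γ, χ.Realize c ↔ χ.Realize c'

theorem Equitype.comp {γ δ : Type*} {c c' : γ → M} (h : Equitype L c c') (g : δ → γ) :
    Equitype L (c ∘ g) (c' ∘ g) := fun χ => by
  simpa only [Formula.realize_relabel] using h (χ.relabel g)

theorem equitype_of_imp {γ : Type*} {c c' : γ → M}
    (h : ∀ χ : L.Formula γ, χ.Realize c → χ.Realize c') : Equitype L c c' := fun χ =>
  ⟨h χ, fun hc' => by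
    by_contra hc
    exact (Formula.realize_not.1 (h χ.not (Formula.realize_not.2 hc))) hc'⟩

/-- A formula expressing that finitely many formulas have a common solution extending a given
tuple. -/
theorem exists_formula_common_solution {ι β γ δ : Type*} [Finite ι] [Finite β]
    (φ : ι → L.Formula δ) (g : δ → γ ⊕ β) :
    ∃ χ : L.Formula γ, ∀ v : γ → M,
      χ.Realize v ↔ ∃ y : β → M, ∀ i, (φ i).Realize (Sum.elim v y ∘ g) :=
  ⟨Formula.iExs β (Formula.iInf fun i => (φ i).relabel g), fun v => by
    simp only [Formula.realize_iExs, Formula.realize_iInf, Formula.realize_relabel]⟩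

variable {κ : Cardinal.{u}}

theorem SaturatedIn.exists_realize_one (hsat : SaturatedIn (M := M) L (Order.succ κ))
    {γ : Type u} (hγ : #γ ≤ κ) (s : γ → M) (p : Set (L.Formula (Fin 1 ⊕ γ)))
    (hp : ∀ fs : Finset (L.Formula (Fin 1 ⊕ γ)), ↑fs ⊆ p →
      ∃ x : M, ∀ φ ∈ fs, φ.Realize (Sum.elim ![x] s)) :
    ∃ x : M, ∀ φ ∈ p, φ.Realize (Sum.elim ![x] s) := by
  classical
  let e : γ → Set.range s := Set.rangeFactorization s
  have he : ∀ (x : M) (φ : L.Formula (Fin 1 ⊕ γ)),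
      (φ.relabel (Sum.map id e)).Realize (Sum.elim ![x] Subtype.val) ↔
        φ.Realize (Sum.elim ![x] s) := by
    intro x φ
    rw [Formula.realize_relabel, Sum.elim_comp_map]
    rfl
  obtain ⟨x, hx⟩ := hsat (Set.range s) (Order.lt_succ_of_le (mk_range_le.trans hγ))
    ((fun φ => φ.relabel (Sum.map id e)) '' p) (by
      intro fs hfs
      obtain ⟨gs, hgs, rfl⟩ := Finset.subset_set_image_iff.1 hfs
      obtain ⟨x, hx⟩ := hp gs hgs
      refine ⟨x, fun φ hφ => ?_⟩
      obtain ⟨ψ, hψ, rfl⟩ := Finset.mem_image.1 hφ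
      exact (he x ψ).2 (hx ψ hψ))
  exact ⟨x, fun φ hφ => (he x φ).1 (hx _ ⟨φ, hφ, rfl⟩)⟩

theorem SaturatedIn.exists_realize (hsat : SaturatedIn (M := M) L (Order.succ κ))
    (hκ : ℵ₀ ≤ κ) {n : ℕ} {γ : Type u} (hγ : #γ ≤ κ) (s : γ → M)
    (p : Set (L.Formula (Fin n ⊕ γ)))
    (hp : ∀ fs : Finset (L.Formula (Fin n ⊕ γ)), ↑fs ⊆ p →
      ∃ x : Fin n → M, ∀ φ ∈ fs, φ.Realize (Sum.elim x s)) :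
    ∃ x : Fin n → M, ∀ φ ∈ p, φ.Realize (Sum.elim x s) := by
  classical
  induction n generalizing γ with
  | zero =>
    refine ⟨Fin.elim0, fun φ hφ => ?_⟩
    obtain ⟨x, hx⟩ := hp {φ} (by simpa using hφ)
    rw [Subsingleton.elim Fin.elim0 x]
    exact hx φ (Finset.mem_singleton_self φ)
  | succ n ih =>
    have hex : ∀ fs : Finset (L.Formula (Fin (n + 1) ⊕ γ)),
        ∃ χ : L.Formula (Fin 1 ⊕ γ), ∀ x : M, χ.Realize (Sum.elim ![x] s) ↔
          ∃ y : Fin n → M, ∀ φ ∈ fs, φ.Realize (Sum.elim (Fin.cons x y : Fin (n + 1) → M) s) := by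
      intro fs
      obtain ⟨χ, hχ⟩ := exists_formula_common_solution (M := M) (fun φ : fs => φ.1)
        (Sum.elim (Fin.cases (Sum.inl (Sum.inl 0)) Sum.inr) (Sum.inl ∘ Sum.inr) :
          Fin (n + 1) ⊕ γ → (Fin 1 ⊕ γ) ⊕ Fin n)
      refine ⟨χ, fun x => (hχ _).trans (exists_congr fun y => ?_)⟩
      have : Sum.elim (Sum.elim ![x] s) y ∘
          (Sum.elim (Fin.cases (Sum.inl (Sum.inl 0)) Sum.inr) (Sum.inl ∘ Sum.inr) :
            Fin (n + 1) ⊕ γ → (Fin 1 ⊕ γ) ⊕ Fin n) =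
          Sum.elim (Fin.cons x y : Fin (n + 1) → M) s := by
        funext i
        rcases i with i | i
        · cases i using Fin.cases <;> rfl
        · rfl
      rw [this, Subtype.forall]
    obtain ⟨x, hx⟩ := hsat.exists_realize_one hγ s
      {χ | ∃ fs : Finset (L.Formula (Fin (n + 1) ⊕ γ)), ↑fs ⊆ p ∧
        ∀ x : M, χ.Realize (Sum.elim ![x] s) ↔ ∃ y : Fin n → M, ∀ φ ∈ fs,
          φ.Realize (Sum.elim (Fin.cons x y : Fin (n + 1) → M) s)} (by
        intro gs hgs
        choose! F hFp hF using hgs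
        obtain ⟨z, hz⟩ := hp (gs.biUnion F) (by
          intro φ hφ
          obtain ⟨χ, hχ, hφχ⟩ := Finset.mem_biUnion.1 hφ
          exact hFp hχ hφχ)
        refine ⟨z 0, fun χ hχ => (hF hχ _).2 ⟨Fin.tail z, fun φ hφ => ?_⟩⟩
        rw [Fin.cons_self_tail]
        exact hz φ (Finset.mem_biUnion.2 ⟨χ, hχ, hφ⟩))
    let g : Fin (n + 1) ⊕ γ → Fin n ⊕ Option γ :=
      Sum.elim (Fin.cases (Sum.inr none) Sum.inl) (Sum.inr ∘ some)
    let s' : Option γ → M := fun o => o.elim x s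
    have hg : ∀ y : Fin n → M, Sum.elim y s' ∘ g =
        Sum.elim (Fin.cons x y : Fin (n + 1) → M) s := by
      intro y
      funext i
      rcases i with i | i
      · cases i using Fin.cases <;> rfl
      · rfl
    obtain ⟨y, hy⟩ := ih (γ := Option γ) (by
      rw [mk_option]
      exact add_le_of_le hκ hγ (one_le_aleph0.trans hκ)) s' ((fun φ => φ.relabel g) '' p) (by
        intro fs hfs
        obtain ⟨gs, hgs, rfl⟩ := Finset.subset_set_image_iff.1 hfs
        obtain ⟨χ, hχ⟩ := hex gs
        obtain ⟨y, hy⟩ := (hχ x).1 (hx χ ⟨gs, hgs, hχ⟩)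
        refine ⟨y, fun φ hφ => ?_⟩
        obtain ⟨ψ, hψ, rfl⟩ := Finset.mem_image.1 hφ
        rw [Formula.realize_relabel, hg]
        exact hy ψ hψ)
    refine ⟨Fin.cons x y, fun φ hφ => ?_⟩
    have := hy _ ⟨φ, hφ, rfl⟩
    rwa [Formula.realize_relabel, hg] at this

theorem SaturatedIn.exists_equitype (hsat : SaturatedIn (M := M) L (Order.succ κ))
    (hκ : ℵ₀ ≤ κ) {γ : Type u} (hγ : #γ ≤ κ) {c c' : γ → M} (h : Equitype L c c')
    {n : ℕ} (b : Fin n → M) : ∃ b' : Fin n → M, Equitype L (Sum.elim b c) (Sum.elim b' c') := by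
  obtain ⟨b', hb'⟩ := hsat.exists_realize hκ hγ c'
    {χ : L.Formula (Fin n ⊕ γ) | χ.Realize (Sum.elim b c)} (by
      intro fs hfs
      obtain ⟨χ, hχ⟩ := exists_formula_common_solution (M := M) (fun φ : fs => φ.1)
        (Sum.swap : Fin n ⊕ γ → γ ⊕ Fin n)
      simp only [Sum.elim_swap] at hχ
      obtain ⟨y, hy⟩ := (hχ c').1 ((h χ).1 ((hχ c).2 ⟨b, fun φ => hfs φ.2⟩))
      exact ⟨y, fun φ hφ => hy ⟨φ, hφ⟩⟩)
  exact ⟨b', equitype_of_imp hb'⟩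

theorem SaturatedIn.exists_equitype_of_finite (hsat : SaturatedIn (M := M) L (Order.succ κ))
    (hκ : ℵ₀ ≤ κ) {γ : Type u} (hγ : #γ ≤ κ) {c c' : γ → M} (h : Equitype L c c')
    {β : Type} [Finite β] (b : β → M) :
    ∃ b' : β → M, Equitype L (Sum.elim b c) (Sum.elim b' c') := by
  obtain ⟨n, ⟨e⟩⟩ := Finite.exists_equiv_fin β
  obtain ⟨b', hb'⟩ := hsat.exists_equitype hκ hγ h (b ∘ e.symm)
  refine ⟨b' ∘ e, ?_⟩
  have := hb'.comp (Sum.map e id)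
  rwa [Sum.elim_comp_map, Sum.elim_comp_map, Function.comp_assoc, e.symm_comp_self] at this

/-- Being large with respect to the instances of finitely many formulas is invariant under
replacing the parameters of a definable set by parameters of the same type. -/
theorem Large.of_equitype (hsat : SaturatedIn (M := M) L (Order.succ κ)) (hκ : ℵ₀ ≤ κ)
    {ι : Type*} {n : ℕ} {ms : ι → ℕ} (φ : ∀ i, L.Formula (Fin n ⊕ Fin (ms i)))
    {N m : ℕ} {γ : Type u} (hγ : #γ ≤ κ) (ψ : L.Formula (Fin n ⊕ γ)) {c c' : γ → M}
    (h : Equitype L c c')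
    (hl : Large (⋃ i, instanceFamily (M := M) (φ i)) N m {x | ψ.Realize (Sum.elim x c)}) :
    Large (⋃ i, instanceFamily (M := M) (φ i)) N m {x | ψ.Realize (Sum.elim x c')} := by
  classical
  induction m generalizing γ with
  | zero =>
    obtain ⟨x, hx⟩ := hl
    obtain ⟨x', hx'⟩ := hsat.exists_equitype hκ hγ h x
    exact ⟨x', (hx' ψ).1 hx⟩
  | succ m ih =>
    obtain ⟨q, Y, I, hY, hI, hl⟩ := hl
    have hY' : ∀ j, ∃ i, ∃ b : Fin (ms i) → M,
        {x | (φ i).Realize (Sum.elim x b)} = Y j := fun j => Set.mem_iUnion.1 (hY j)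
    choose l b hb using hY'
    let β : Type := Σ j : Fin q, Fin (ms (l j))
    obtain ⟨b', hb'⟩ := hsat.exists_equitype_of_finite hκ hγ h fun p : β => b p.1 p.2
    refine ⟨q, fun j => {x | (φ (l j)).Realize (Sum.elim x fun i => b' ⟨j, i⟩)}, I,
      fun j => Set.mem_iUnion.2 ⟨l j, _, rfl⟩, hI, fun i => ?_⟩
    let g : Fin n ⊕ γ → Fin n ⊕ (β ⊕ γ) := Sum.map id Sum.inr
    let gs : ∀ j, Fin n ⊕ Fin (ms (l j)) → Fin n ⊕ (β ⊕ γ) :=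
      fun j => Sum.map id fun i => Sum.inl ⟨j, i⟩
    let χ : L.Formula (Fin n ⊕ (β ⊕ γ)) := ψ.relabel g ⊓ Formula.iInf fun j =>
      if j ∈ I i then (φ (l j)).relabel (gs j) else ((φ (l j)).relabel (gs j)).not
    have hχ : ∀ (x : Fin n → M) (b : β → M) (c : γ → M),
        χ.Realize (Sum.elim x (Sum.elim b c)) ↔ ψ.Realize (Sum.elim x c) ∧
          ∀ j, (φ (l j)).Realize (Sum.elim x fun i => b ⟨j, i⟩) ↔ j ∈ I i := by
      intro x b c
      simp only [χ, Formula.realize_inf, Formula.realize_iInf]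
      refine and_congr ?_ (forall_congr' fun j => ?_)
      · rw [Formula.realize_relabel, Sum.elim_comp_map]
        rfl
      · have : ((φ (l j)).relabel (gs j)).Realize (Sum.elim x (Sum.elim b c)) ↔
            (φ (l j)).Realize (Sum.elim x fun i => b ⟨j, i⟩) := by
          rw [Formula.realize_relabel, Sum.elim_comp_map]
          rfl
        split_ifs with hj
        · simp [this, hj]
        · simp [this, hj]
    have hcard : #(β ⊕ γ) ≤ κ := by
      rw [mk_sum, lift_uzero]
      refine add_le_of_le hκ ?_ (by simpa using hγ)
      rw [← lift_aleph0.{u, 0}] at hκ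
      exact (lift_le.2 (mk_le_aleph0 (α := β))).trans hκ
    refine (ih hcard χ hb' ((hl i).mono ?_)).mono ?_
    · rintro x ⟨hx, hxj⟩
      refine (hχ _ _ _).2 ⟨hx, fun j => ?_⟩
      have := hxj j
      rw [← hb j] at this
      exact this
    · intro x hx
      exact (hχ _ _ _).1 hx

end Saturation

section Forking

variable {L : FirstOrder.Language.{u, u}} {M : Type u} [L.Structure M]

theorem exists_finite_parameters {α β : Type*} (φ : L.Formula (α ⊕ β)) :
    ∃ (q : ℕ) (e : Fin q → β) (ψ : L.Formula (α ⊕ Fin q)), ∀ (v : α → M) (w : β → M),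
      φ.Realize (Sum.elim v w) ↔ ψ.Realize (Sum.elim v (w ∘ e)) := by
  classical
  let P : Set β := Sum.inr ⁻¹' (φ.freeVarFinset : Set (α ⊕ β))
  have hP : Finite P :=
    (φ.freeVarFinset.finite_toSet.preimage Sum.inr_injective.injOn).to_subtype
  obtain ⟨q, ⟨e⟩⟩ := Finite.exists_equiv_fin P
  let f : φ.freeVarFinset → α ⊕ Fin q := fun a =>
    match a with
    | ⟨Sum.inl a, _⟩ => Sum.inl a
    | ⟨Sum.inr b, h⟩ => Sum.inr (e ⟨b, h⟩)
  refine ⟨q, fun i => (e.symm i).1, φ.restrictFreeVar f, fun v w =>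
    (BoundedFormula.realize_restrictFreeVar (Sum.elim v w) ?_).symm⟩
  rintro ⟨a | b, h⟩
  · rfl
  · simp [f]

variable {κ : Cardinal.{u}}

/-- If the type of `d` over `A₁` is implied by its restriction to `S`, then so is the type of `d`
over any set in which `A₁` is relatively saturated. -/
theorem RelKappaSaturated.sameTypeOver (hsat : SaturatedIn (M := M) L (Order.succ κ))
    (hκ : ℵ₀ ≤ κ) {A A₁ S : Set M} (h : RelKappaSaturated (L := L) κ A₁ A) (hS : S ⊆ A₁)
    (hSκ : #S < κ) {n : ℕ} {d : Fin n → M}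
    (hd : ∀ d' : Fin n → M, SameTypeOver (L := L) S d d' → SameTypeOver (L := L) A₁ d d')
    {d' : Fin n → M} (hd' : SameTypeOver (L := L) S d d') : SameTypeOver (L := L) A d d' := by
  intro φ
  obtain ⟨q, e, ψ, hψ⟩ := exists_finite_parameters (M := M) φ
  rw [hψ, hψ]
  let a : Fin q → M := Subtype.val ∘ e
  obtain ⟨b, hbA, hab⟩ := h.2 S hS hSκ q a fun i => (e i).2
  have key : ∀ x : Fin n → M, SameTypeOver (L := L) S d x →
      (ψ.Realize (Sum.elim x a) ↔ ψ.Realize (Sum.elim d b)) := by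
    intro x hx
    have hcard : #(ULift.{u} (Fin q) ⊕ S) ≤ κ := by
      rw [mk_sum, lift_id, lift_id]
      exact add_le_of_le hκ (mk_le_aleph0.trans hκ) hSκ.le
    have hab' : Equitype L
        (Sum.elim (a ∘ ULift.down) Subtype.val : ULift.{u} (Fin q) ⊕ S → M)
        (Sum.elim (b ∘ ULift.down) Subtype.val) := by
      have := Equitype.comp (L := L) hab (Sum.map ULift.down.{u} id)
      rwa [Sum.elim_comp_map, Sum.elim_comp_map] at this
    obtain ⟨y, hy⟩ := hsat.exists_equitype hκ hcard hab' x
    have hxy : SameTypeOver (L := L) S x y := hy.comp (Sum.map id Sum.inr) |> fun this => by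
      rwa [Sum.elim_comp_map, Sum.elim_comp_map] at this
    have hxay : Equitype L (Sum.elim x a) (Sum.elim y b) :=
      hy.comp (Sum.map id fun i => Sum.inl ⟨i⟩) |> fun this => by
        rwa [Sum.elim_comp_map, Sum.elim_comp_map] at this
    have hdy := hd y fun χ => (hx χ).trans (hxy χ)
    have := hdy (ψ.relabel (Sum.map id fun i => ⟨b i, hbA i⟩))
    rw [Formula.realize_relabel, Formula.realize_relabel, Sum.elim_comp_map,
      Sum.elim_comp_map] at this
    exact (hxay ψ).trans this.symm
  exact (key d fun _ => Iff.rfl).trans (key d' hd').symm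

/-- Compactness: if every realization of `tp(d / S)` satisfies one of finitely many formulas,
then so does every realization of some formula in `tp(d / S)`. -/
theorem SaturatedIn.exists_formula_of_cover (hsat : SaturatedIn (M := M) L (Order.succ κ))
    (hκ : ℵ₀ ≤ κ) {S : Set M} (hS : #S ≤ κ) {n r : ℕ} {d : Fin n → M} {ms : Fin r → ℕ}
    (φ : ∀ i, L.Formula (Fin n ⊕ Fin (ms i))) (b : ∀ i, Fin (ms i) → M)
    (h : ∀ d' : Fin n → M, SameTypeOver (L := L) S d d' →
      ∃ i, (φ i).Realize (Sum.elim d' (b i))) :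
    ∃ θ : L.Formula (Fin n ⊕ S), θ.Realize (Sum.elim d Subtype.val) ∧
      ∀ x : Fin n → M, θ.Realize (Sum.elim x Subtype.val) →
        ∃ i, (φ i).Realize (Sum.elim x (b i)) := by
  classical
  by_contra! hcon
  let γ : Type u := S ⊕ ULift.{u} (Σ i, Fin (ms i))
  let s : γ → M := Sum.elim Subtype.val fun p => b p.down.1 p.down.2
  have hγ : #γ ≤ κ := by
    rw [mk_sum, lift_id, lift_id]
    exact add_le_of_le hκ hS (mk_le_aleph0.trans hκ)
  obtain ⟨x, hx⟩ := hsat.exists_realize hκ hγ s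
    {χ : L.Formula (Fin n ⊕ γ) | ∃ θ : L.Formula (Fin n ⊕ S),
      θ.Realize (Sum.elim d Subtype.val) ∧ ∀ x : Fin n → M, χ.Realize (Sum.elim x s) ↔
        θ.Realize (Sum.elim x Subtype.val) ∧ ∀ i, ¬ (φ i).Realize (Sum.elim x (b i))} (by
      intro fs hfs
      choose θ hθd hθ using fun χ : fs => hfs χ.2
      obtain ⟨x, hx, hxφ⟩ := hcon (Formula.iInf θ) (by rwa [Formula.realize_iInf])
      rw [Formula.realize_iInf] at hx
      exact ⟨x, fun χ hχ => (hθ ⟨χ, hχ⟩ x).2 ⟨hx ⟨χ, hχ⟩, hxφ⟩⟩)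
  have hall : ∀ θ : L.Formula (Fin n ⊕ S), θ.Realize (Sum.elim d Subtype.val) →
      θ.Realize (Sum.elim x Subtype.val) ∧ ∀ i, ¬ (φ i).Realize (Sum.elim x (b i)) := by
    intro θ hθ
    let χ : L.Formula (Fin n ⊕ γ) := θ.relabel (Sum.map id Sum.inl) ⊓
      Formula.iInf fun i => ((φ i).relabel (Sum.map id fun j => Sum.inr ⟨⟨i, j⟩⟩)).not
    have hχ : ∀ x : Fin n → M, χ.Realize (Sum.elim x s) ↔
        θ.Realize (Sum.elim x Subtype.val) ∧ ∀ i, ¬ (φ i).Realize (Sum.elim x (b i)) := by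
      intro x
      simp only [χ, Formula.realize_inf, Formula.realize_iInf, Formula.realize_not,
        Formula.realize_relabel, Sum.elim_comp_map]
      rfl
    exact (hχ x).1 (hx χ ⟨θ, hθ, hχ⟩)
  obtain ⟨i, hi⟩ := h x (equitype_of_imp fun θ hθ => (hall θ hθ).1)
  exact (hall ⊤ (by simp)).2 i hi

theorem IndiscOver.equitype {C S : Set M} (hS : S ⊆ C) {m : ℕ} {f : ℕ → Fin m → M}
    (hf : IndiscOver (L := L) C f) (i j : ℕ) :
    Equitype L (Sum.elim (f i) (Subtype.val : S → M)) (Sum.elim (f j) Subtype.val) := by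
  have h : Equitype L _ _ := hf 1 (fun _ => i) (fun _ => j) (Subsingleton.strictMono _)
    (Subsingleton.strictMono _)
  have := h.comp (Sum.map (fun t : Fin m => ((0 : Fin 1), t)) (Set.inclusion hS))
  rwa [Sum.elim_comp_map, Sum.elim_comp_map] at this

/-- In a saturated structure, a definable set covered by finitely many dividing instances is
arbitrarily large. -/
theorem large_of_divides_cover (hsat : SaturatedIn (M := M) L (Order.succ κ)) (hκ : ℵ₀ ≤ κ)
    {C S : Set M} (hSC : S ⊆ C) (hS : #S ≤ κ) {n r : ℕ} {ms : Fin r → ℕ}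
    (φ : ∀ i, L.Formula (Fin n ⊕ Fin (ms i))) (b : ∀ i, Fin (ms i) → M)
    (hdiv : ∀ i, Divides (L := L) C (φ i) (b i)) (θ : L.Formula (Fin n ⊕ S))
    (hne : ∃ x : Fin n → M, θ.Realize (Sum.elim x Subtype.val))
    (hcov : ∀ x : Fin n → M, θ.Realize (Sum.elim x Subtype.val) →
      ∃ i, (φ i).Realize (Sum.elim x (b i))) (m N : ℕ) :
    Large (⋃ i, instanceFamily (M := M) (φ i)) N m
      {x | θ.Realize (Sum.elim x Subtype.val)} := by
  classical
  set X : Set (Fin n → M) := {x | θ.Realize (Sum.elim x Subtype.val)} with hX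
  induction m generalizing N with
  | zero => exact hne
  | succ m ih =>
    have : Nonempty (Fin r) := let ⟨x, hx⟩ := hne; (hcov x hx).nonempty
    have hXU : X = ⋃ i, X ∩ {x | (φ i).Realize (Sum.elim x (b i))} := by
      ext x
      simp only [Set.mem_iUnion, Set.mem_inter_iff, Set.mem_ofPred_eq, exists_and_left]
      exact ⟨fun hx => ⟨hx, hcov x hx⟩, fun hx => hx.1⟩
    rw [hXU] at ih
    obtain ⟨i, hi⟩ := exists_large_of_iUnion ih
    obtain ⟨f, hf0, hf, k, -, hk⟩ := hdiv i
    refine large_succ_of_inconsistent (Z := fun j => {x | (φ i).Realize (Sum.elim x (f j))})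
      ?_ (k := k) ?_ ?_ N
    · exact fun j => Set.mem_iUnion.2 ⟨i, f j, rfl⟩
    · intro s hs x _
      by_contra! hcon
      exact hk (s.orderEmbOfFin hs) (s.orderEmbOfFin hs).strictMono
        ⟨x, fun j => hcon (s.orderEmbOfFin hs j) (s.orderEmbOfFin_mem hs j)⟩
    · intro j N
      let ψ : L.Formula (Fin n ⊕ (ULift.{u} (Fin (ms i)) ⊕ S)) :=
        θ.relabel (Sum.map id Sum.inr) ⊓ (φ i).relabel (Sum.map id fun t => Sum.inl ⟨t⟩)
      let c : ℕ → ULift.{u} (Fin (ms i)) ⊕ S → M := fun j =>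
        Sum.elim (f j ∘ ULift.down) Subtype.val
      have hψ : ∀ j, {x : Fin n → M | ψ.Realize (Sum.elim x (c j))} =
          X ∩ {x | (φ i).Realize (Sum.elim x (f j))} := by
        intro j
        ext x
        simp only [ψ, hX, Set.mem_ofPred_eq, Set.mem_inter_iff, Formula.realize_inf,
          Formula.realize_relabel, Sum.elim_comp_map]
        rfl
      have hcard : #(ULift.{u} (Fin (ms i)) ⊕ S) ≤ κ := by
        rw [mk_sum, lift_id, lift_id]
        exact add_le_of_le hκ (mk_le_aleph0.trans hκ) hS
      have hc : Equitype L (c 0) (c j) := by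
        have := (hf.equitype hSC 0 j).comp (Sum.map ULift.down.{u} id)
        rwa [Sum.elim_comp_map, Sum.elim_comp_map] at this
      have := hi N
      rw [← hf0, ← hψ] at this
      rw [← hψ]
      exact Large.of_equitype hsat hκ φ hcard ψ hc this

end Forking

/-- If `A₁` is relatively `κ`-saturated in `A` and `D` is `κ`-atomic
over `A₁`, then `D` is independent from `A` over `A₁`. -/
theorem indep_of_kappaAtomic {L : FirstOrder.Language.{u, u}} {M : Type u}
    [L.Structure M] (κ : Cardinal.{u}) (hstable : Stable L (L.completeTheory M))
    (hreg : κ.IsRegular) (hpow : κ ^ cardL L = κ)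
    (hMsat : SaturatedIn (M := M) L (Order.succ κ))
    (A A₁ D : Set M)
    (h1 : RelKappaSaturated (L := L) κ A₁ A)
    (h2 : KappaAtomicOver (L := L) κ D A₁) :
    IndepOver (L := L) D A A₁ := by
  rintro n d hd ⟨r, ms, φ, b, hdiv, hcov⟩
  have hκ := hreg.aleph0_le
  obtain ⟨S, hSA, hSκ, hS⟩ := h2 n d hd
  rw [Set.union_eq_left.2 h1.1] at hcov
  obtain ⟨θ, hθ, hθcov⟩ := hMsat.exists_formula_of_cover hκ hSκ.le φ b fun d' hd' =>
    hcov d' (h1.sameTypeOver hMsat hκ hSA hSκ hS hd')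
  have : Nonempty (Fin r) := (hθcov d hθ).nonempty
  have htree : ∀ m, SplitTree (⋃ i, instanceFamily (M := M) (φ i)) m Set.univ := fun m =>
    (large_of_divides_cover hMsat hκ hSA hSκ.le φ b hdiv θ ⟨d, hθ⟩ hθcov m 2).splitTree.mono
      (Set.subset_univ _)
  by_contra
  have hfail : ∀ i, ∃ m, ¬ SplitTree (instanceFamily (M := M) (φ i)) m Set.univ := by
    intro i
    by_contra! hi
    exact not_stable_of_splitTree (φ i) hi hstable
  choose a ha using hfail
  obtain ⟨i, hi⟩ := SplitTree.exists_of_iUnion a rfl (htree _)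
  exact ha i hi

end Benign
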